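/- arXiv:1406.5275 — 2 statements merged into one kernel-verified Lean document; each statement's English description precedes it below -/
import Mathlib

section
/- Let λ : (0, ∞) → ℝ be non-increasing (i.e., 0 < r ≤ s implies λ(s) ≤ λ(r)), let μ(r) := r·λ(r) be non-decreasing on (0, ∞), and let λ₁, μ₁ ∈ ℝ. Define R := ⋃_{r>0} { (x, y) ∈ ℝ² : x > λ(r) and y > μ(r) } and Σ := ⋃_{r>0} { (x, y) ∈ ℝ² : λ₁ < x < λ(r) and μ₁ < y < μ(r) }. Then R ∩ Σ = ∅. -/
/-- Disjointness of the regions `R` and `Σ` determined by the monotone curve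
`r ↦ (l(r), r·l(r))`. -/
theorem regions_disjoint (l : ℝ → ℝ) (lam1 mu1 : ℝ)
    (hdec : ∀ r s : ℝ, 0 < r → r ≤ s → l s ≤ l r)
    (hinc : ∀ r s : ℝ, 0 < r → r ≤ s → r * l r ≤ s * l s) :
    (⋃ r ∈ Set.Ioi (0 : ℝ), {p : ℝ × ℝ | l r < p.1 ∧ r * l r < p.2}) ∩
      (⋃ r ∈ Set.Ioi (0 : ℝ),
        {p : ℝ × ℝ | lam1 < p.1 ∧ p.1 < l r ∧ mu1 < p.2 ∧ p.2 < r * l r}) = ∅ := by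
  ext p
  simp only [Set.mem_inter_iff, Set.mem_iUnion, Set.mem_Ioi, Set.mem_ofPred_eq,
    Set.mem_empty_iff_false, iff_false]
  rintro ⟨⟨r, hr, hx, hy⟩, ⟨s, hs, -, hx', -, hy'⟩⟩
  rcases le_total r s with h | h
  · exact absurd (hx.trans hx') (hdec r s hr h).not_gt
  · exact absurd (hy.trans hy') (hinc s r hs h).not_gt
end

section
/- Let (Ω, μ) be a finite measure space, let u : Ω → ℝ be measurable, and let p, t, p* be real numbers with p > 0 and 0 < t < p*. Let C > 0 and suppose that ∫ |u|^(p*) dμ < ∞ and that for every real k > 0 the recursive estimate (∫ |u|^(p*(k+1)) dμ)^(1/(p*(k+1))) ≤ C^(1/(k+1)) · ((k+1)/(k·p+1)^(1/p))^(1/(k+1)) · (∫ |u|^(t(k+1)) dμ)^(1/(t(k+1))) holds (as an inequality in the extended nonnegative reals). Then u is essentially bounded, i.e., its essential supremum with respect to μ is finite. -/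
open MeasureTheory ENNReal

open Filter Topology in
/-- Bounds on the `L^q` norms along exponents tending to infinity pass to the essential supremum. -/
theorem essSup_le_of_lintegral_rpow_le {Ω ι : Type*} [MeasurableSpace Ω] {μ : Measure Ω}
    {f : Ω → ℝ≥0∞} (hf : AEMeasurable f μ) {l : Filter ι} [l.NeBot] {q : ι → ℝ}
    (hq : Tendsto q l atTop) {M : ℝ≥0∞}
    (hM : ∀ᶠ i in l, (∫⁻ x, f x ^ q i ∂μ) ^ (1 / q i) ≤ M) :
    essSup f μ ≤ M := by
  refine le_of_forall_gt_imp_ge_of_dense fun c hc => ?_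
  rcases eq_or_ne c ⊤ with rfl | hc_top
  · exact le_top
  have hc0 : c ≠ 0 := (zero_le.trans_lt hc).ne'
  have hlim : Tendsto (fun i => (M / c) ^ q i) l (𝓝 0) :=
    (ENNReal.tendsto_rpow_atTop_of_base_lt_one
      ((ENNReal.div_lt_iff (.inl hc0) (.inl hc_top)).2 (by rwa [one_mul]))).comp hq
  have hmeas : μ {x | c ≤ f x} ≤ 0 := by
    refine ge_of_tendsto hlim ?_
    filter_upwards [hM, hq.eventually_gt_atTop 0] with i hi hqi
    have hset : {x | c ≤ f x} = {x | c ^ q i ≤ f x ^ q i} := by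
      ext x
      exact (ENNReal.rpow_le_rpow_iff hqi).symm
    rw [hset, ENNReal.div_rpow_of_nonneg _ _ hqi.le]
    refine (meas_ge_le_lintegral_div (hf.pow_const _) (ENNReal.rpow_pos_of_nonneg
      (pos_iff_ne_zero.2 hc0) hqi.le).ne' (ENNReal.rpow_ne_top_of_nonneg hqi.le hc_top)).trans ?_
    gcongr
    rwa [one_div, ENNReal.rpow_inv_le_iff hqi] at hi
  refine essSup_le_of_ae_le c ?_
  filter_upwards [measure_eq_zero_iff_ae_notMem.1 (nonpos_iff_eq_zero.1 hmeas)] with x hx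
  exact (not_le.1 hx).le

/-- Iterating a recursive estimate whose logarithmic factors are summable. -/
theorem le_ofReal_exp_tsum_mul_of_succ_le {a : ℕ → ℝ≥0∞} {c : ℕ → ℝ} (hc0 : ∀ n, 0 ≤ c n)
    (hc : Summable c) (ha : ∀ n, a (n + 1) ≤ ENNReal.ofReal (Real.exp (c n)) * a n) (n : ℕ) :
    a n ≤ ENNReal.ofReal (Real.exp (∑' i, c i)) * a 0 := by
  have key : a n ≤ ENNReal.ofReal (Real.exp (∑ i ∈ Finset.range n, c i)) * a 0 := by
    induction n with
    | zero => simp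
    | succ n ih =>
      calc a (n + 1) ≤ ENNReal.ofReal (Real.exp (c n)) * a n := ha n
        _ ≤ ENNReal.ofReal (Real.exp (c n)) *
            (ENNReal.ofReal (Real.exp (∑ i ∈ Finset.range n, c i)) * a 0) := by gcongr
        _ = _ := by
          rw [← mul_assoc, ← ENNReal.ofReal_mul (Real.exp_pos _).le, ← Real.exp_add,
            Finset.sum_range_succ, add_comm]
  refine key.trans ?_
  gcongr
  exact hc.sum_le_tsum _ fun i _ => hc0 i

theorem ofReal_rpow_mul_ofReal_rpow_le_exp {p C k : ℝ} (hp : 0 < p) (hk : 0 < k) :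
    ENNReal.ofReal C ^ (1 / (k + 1)) *
        ENNReal.ofReal ((k + 1) / (k * p + 1) ^ (1 / p)) ^ (1 / (k + 1)) ≤
      ENNReal.ofReal (Real.exp ((Real.log (max C 1) + Real.log (k + 1)) / (k + 1))) := by
  have hD : 0 < max C 1 := lt_max_of_lt_right one_pos
  have hk1 : 0 < k + 1 := by positivity
  have hfac : (k + 1) / (k * p + 1) ^ (1 / p) ≤ k + 1 :=
    div_le_self hk1.le (Real.one_le_rpow (by nlinarith [mul_pos hk hp]) (by positivity))
  calc _ ≤ ENNReal.ofReal (max C 1) ^ (1 / (k + 1)) * ENNReal.ofReal (k + 1) ^ (1 / (k + 1)) := by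
        gcongr
        exact le_max_left _ _
    _ = _ := by
        rw [← ENNReal.mul_rpow_of_nonneg _ _ (by positivity), ← ENNReal.ofReal_mul hD.le,
          ENNReal.ofReal_rpow_of_pos (by positivity), Real.rpow_def_of_pos (by positivity),
          Real.log_mul hD.ne' hk1.ne', mul_one_div]

theorem summable_add_log_pow_div_pow {r : ℝ} (hr : 1 < r) (b : ℝ) :
    Summable fun n : ℕ => (b + Real.log (r ^ (n + 1))) / r ^ (n + 1) := by
  have hr' : ‖r⁻¹‖ < 1 := by
    rw [Real.norm_of_nonneg (by positivity)]
    exact inv_lt_one_of_one_lt₀ hr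
  have h := ((summable_pow_mul_geometric_of_norm_lt_one 0 hr').mul_left b).add
    ((summable_pow_mul_geometric_of_norm_lt_one 1 hr').mul_left (Real.log r))
  refine ((summable_nat_add_iff 1).2 h).congr fun n => ?_
  rw [Real.log_pow, inv_pow, div_eq_mul_inv]
  ring

/-- Bootstrap (Moser-type) iteration concluding the proof of Lemma B.1: from
`u ∈ L^{p*}` and the recursive norm estimate, conclude that `u` is essentially
bounded. -/
theorem bootstrap_essentially_bounded {Ω : Type*} [MeasurableSpace Ω]
    (μ : Measure Ω) [IsFiniteMeasure μ] (u : Ω → ℝ) (hu : Measurable u)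
    (p t pstar : ℝ) (hp : 0 < p) (ht : 0 < t) (htp : t < pstar)
    (C : ℝ) (hC : 0 < C)
    (hbase : ∫⁻ x, ENNReal.ofReal |u x| ^ pstar ∂μ < ⊤)
    (hrec : ∀ k : ℝ, 0 < k →
      (∫⁻ x, ENNReal.ofReal |u x| ^ (pstar * (k + 1)) ∂μ) ^ (1 / (pstar * (k + 1))) ≤
        ENNReal.ofReal C ^ (1 / (k + 1)) *
          ENNReal.ofReal ((k + 1) / (k * p + 1) ^ (1 / p)) ^ (1 / (k + 1)) *
          (∫⁻ x, ENNReal.ofReal |u x| ^ (t * (k + 1)) ∂μ) ^ (1 / (t * (k + 1)))) :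
    essSup (fun x => ENNReal.ofReal |u x|) μ < ⊤ := by
  have hps : 0 < pstar := ht.trans htp
  set r : ℝ := pstar / t with hr_def
  have hr : 1 < r := (one_lt_div ht).2 htp
  let a : ℕ → ℝ≥0∞ := fun n =>
    (∫⁻ x, ENNReal.ofReal |u x| ^ (pstar * r ^ n) ∂μ) ^ (1 / (pstar * r ^ n))
  let c : ℕ → ℝ := fun n => (Real.log (max C 1) + Real.log (r ^ (n + 1))) / r ^ (n + 1)
  have hc0 (n : ℕ) : 0 ≤ c n :=
    div_nonneg (add_nonneg (Real.log_nonneg (le_max_right _ _))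
      (Real.log_nonneg (one_le_pow₀ hr.le))) (by positivity)
  have hstep (n : ℕ) : a (n + 1) ≤ ENNReal.ofReal (Real.exp (c n)) * a n := by
    have hk : 0 < r ^ (n + 1) - 1 := sub_pos.2 (one_lt_pow₀ hr n.succ_ne_zero)
    have hexp : t * r ^ (n + 1) = pstar * r ^ n := by
      rw [pow_succ, hr_def]
      field_simp
    have hrec' := hrec _ hk
    have hconst := ofReal_rpow_mul_ofReal_rpow_le_exp (C := C) hp hk
    rw [sub_add_cancel] at hrec' hconst
    rw [hexp] at hrec'
    exact hrec'.trans (mul_le_mul_left hconst _)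
  have ha0 : a 0 < ⊤ := by
    simpa only [a, pow_zero, mul_one] using ENNReal.rpow_lt_top_of_nonneg (by positivity) hbase.ne
  refine (essSup_le_of_lintegral_rpow_le hu.abs.ennreal_ofReal.aemeasurable
    ((tendsto_pow_atTop_atTop_of_one_lt hr).const_mul_atTop hps)
    (.of_forall (le_ofReal_exp_tsum_mul_of_succ_le hc0
      (summable_add_log_pow_div_pow hr _) hstep))).trans_lt ?_
  exact ENNReal.mul_lt_top ENNReal.ofReal_lt_top ha0
end
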